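/- arXiv:2009.03889 — 3 statements merged into one kernel-verified Lean document; each statement's English description precedes it below -/
import Mathlib

section
/- Let n be a positive integer with n ≡ 2 (mod 3). Then, as rational functions of q, Σ_{k=0}^{(2n-1)/3} ((q;q^3)_k^3 / (q^3;q^3)_k^3) q^{3k} ≡ q^{(2n-1)/3} · ((q^2;q^3)_{(2n-1)/3}^2 / (q^3;q^3)_{(2n-1)/3}^2) · { 1 − [2n]^2 Σ_{i=1}^{(2n-1)/3} q^{3i-1} / [3i-1]^2 } modulo Φ_n(q)^3. -/
open Finset

/-- The `q`-shifted factorial `(x; q)_k = (1-x)(1-xq)⋯(1-xq^{k-1})`. -/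
noncomputable def qPoch {K : Type*} [CommRing K] (x q : K) (k : ℕ) : K :=
  ∏ i ∈ Finset.range k, (1 - x * q ^ i)

/-- The `q`-integer `[m] = (1-q^m)/(1-q)` as a rational function of `q`. -/
noncomputable def qint (m : ℕ) : RatFunc ℚ :=
  (1 - RatFunc.X ^ m) / (1 - RatFunc.X)

/-- Congruence of rational functions modulo a polynomial: `A ≡ B (mod P)` means
`A - B = P * r / s` with `s` a nonzero polynomial coprime to `P`. -/
def ratCongr (A B : RatFunc ℚ) (P : Polynomial ℚ) : Prop :=
  ∃ r s : Polynomial ℚ, s ≠ 0 ∧ IsRelPrime s P ∧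
    A - B = algebraMap (Polynomial ℚ) (RatFunc ℚ) (P * r) /
            algebraMap (Polynomial ℚ) (RatFunc ℚ) s


section Saalschutz

variable {K : Type*} [Field K]

theorem qPoch_succ {R : Type*} [CommRing R] (x q : R) (k : ℕ) :
    qPoch x q (k + 1) = qPoch x q k * (1 - x * q ^ k) :=
  Finset.prod_range_succ _ _

theorem qPoch_zero {R : Type*} [CommRing R] (x q : R) : qPoch x q 0 = 1 :=
  Finset.prod_range_zero _

/-- The connection coefficients in the polynomial form of the `q`-Saalschütz summation, see
`prod_eq_sum_saalCoeff`. -/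
noncomputable def saalCoeff (m Q : K) (k i : ℕ) : K :=
  Q ^ k * qPoch Q Q (k + i) ^ 2 / (qPoch Q Q i * qPoch Q Q k ^ 2) *
    ∏ j ∈ range i, (m - Q ^ (j + 1))

variable {m Q : K}

theorem one_sub_pow_ne_zero (hQ : ∀ k, qPoch Q Q k ≠ 0) (k : ℕ) : 1 - Q * Q ^ k ≠ 0 := by
  have := hQ (k + 1)
  rw [qPoch_succ] at this
  exact right_ne_zero_of_mul this

theorem saalCoeff_ratio (hQ : ∀ k, qPoch Q Q k ≠ 0) (k i : ℕ) :
    saalCoeff m Q (k + 1) i * ((1 - Q ^ (k + 1)) ^ 2 * (m - Q ^ (i + 1))) =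
      Q * (1 - Q ^ (i + 1)) * saalCoeff m Q k (i + 1) := by
  have h1 := hQ i
  have h2 := hQ k
  have h3 := one_sub_pow_ne_zero hQ i
  have h4 := one_sub_pow_ne_zero hQ k
  rw [saalCoeff, saalCoeff, show k + 1 + i = k + (i + 1) by ring, qPoch_succ Q Q k,
    qPoch_succ Q Q i, prod_range_succ]
  field_simp
  ring

theorem saalCoeff_succ_succ (hQ : ∀ k, qPoch Q Q k ≠ 0) (k i : ℕ) :
    saalCoeff m Q (k + 1) (i + 1) = Q ^ (i + 2) * saalCoeff m Q k (i + 1) +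
      (m - Q ^ (i + 1)) * (1 - Q ^ (i + 2 * (k + 1) + 1)) * saalCoeff m Q (k + 1) i := by
  have h1 := hQ i
  have h2 := hQ k
  have h3 := one_sub_pow_ne_zero hQ i
  have h4 := one_sub_pow_ne_zero hQ k
  rw [saalCoeff, saalCoeff, saalCoeff, show k + 1 + (i + 1) = k + i + 1 + 1 by ring,
    show k + 1 + i = k + i + 1 by ring, show k + (i + 1) = k + i + 1 by ring,
    qPoch_succ Q Q (k + i + 1), qPoch_succ Q Q k, qPoch_succ Q Q i, prod_range_succ]
  field_simp
  ring

theorem saalCoeff_zero_right (hQ : ∀ k, qPoch Q Q k ≠ 0) (k : ℕ) :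
    saalCoeff m Q k 0 = Q ^ k := by
  have := hQ k
  simp [saalCoeff, qPoch_zero, this]

theorem saalCoeff_zero_left (hQ : ∀ k, qPoch Q Q k ≠ 0) (i : ℕ) :
    saalCoeff m Q 0 i = qPoch Q Q i * ∏ j ∈ range i, (m - Q ^ (j + 1)) := by
  have := hQ i
  rw [saalCoeff, qPoch_zero, zero_add]
  field_simp

/-- Polynomial form of the `q`-Saalschütz summation with lower parameter `Q`. -/
theorem prod_eq_sum_saalCoeff (hQ : ∀ k, qPoch Q Q k ≠ 0) (m s : K) (N : ℕ) :
    ∏ j ∈ range N, (m - s * Q ^ (j + 1) + Q ^ (2 * (j + 1))) =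
      ∑ x ∈ antidiagonal N, saalCoeff m Q x.1 x.2 *
        ∏ j ∈ range x.1, (1 - s * Q ^ j + m * Q ^ (2 * j)) := by
  induction N with
  | zero => simp [saalCoeff, qPoch_zero]
  | succ N ih =>
    let R : ℕ → K := fun k ↦ ∏ j ∈ range k, (1 - s * Q ^ j + m * Q ^ (2 * j))
    have hR (k) : R (k + 1) = R k * (1 - s * Q ^ k + m * Q ^ (2 * k)) := prod_range_succ _ _
    let a : ℕ → ℕ → K := fun k i ↦ Q ^ (i + 1) * saalCoeff m Q k i * R (k + 1)
    let b : ℕ → ℕ → K := fun k i ↦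
      (m - Q ^ (i + 1)) * (1 - Q ^ (i + 2 * k + 1)) * saalCoeff m Q k i * R k
    let A : ℕ × ℕ → K := fun x ↦ Nat.casesOn x.1 0 fun k ↦ a k x.2
    let B : ℕ × ℕ → K := fun x ↦ Nat.casesOn x.2 0 fun i ↦ b x.1 i
    have hA0 (i) : A (0, i) = 0 := rfl
    have hA (k i) : A (k + 1, i) = a k i := rfl
    have hB0 (k) : B (k, 0) = 0 := rfl
    have hB (k i) : B (k, i + 1) = b k i := rfl
    have key : ∀ x ∈ antidiagonal (N + 1), saalCoeff m Q x.1 x.2 * R x.1 = A x + B x := by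
      rintro ⟨_ | k, _ | i⟩ hx
      · simp at hx
      · rw [hA0, hB, saalCoeff_zero_left hQ, qPoch_succ, prod_range_succ]
        simp only [b]
        rw [saalCoeff_zero_left hQ]
        ring
      · rw [hA, hB0, saalCoeff_zero_right hQ]
        simp only [a]
        rw [saalCoeff_zero_right hQ]
        ring
      · rw [hA, hB, saalCoeff_succ_succ hQ]
        ring
    rw [sum_congr rfl key, sum_add_distrib, Finset.Nat.sum_antidiagonal_succ (f := A),
      Finset.Nat.sum_antidiagonal_succ' (f := B), prod_range_succ, ih, sum_mul]
    simp only [hA0, hA, hB0, hB, zero_add]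
    rw [← sum_add_distrib]
    refine sum_congr rfl fun x hx ↦ ?_
    obtain ⟨k, i⟩ := x
    rw [HasAntidiagonal.mem_antidiagonal] at hx
    simp only at hx
    subst hx
    simp only [a, b, hR]
    change _ * R k * _ = _
    ring

theorem prod_mul_pow_sub_pow (x Q : K) (M : ℕ) :
    ∏ j ∈ range M, (x * Q ^ M - Q ^ (j + 1)) =
      (∏ j ∈ range M, -Q ^ (j + 1)) * qPoch x Q M := by
  rw [qPoch, ← prod_range_reflect (fun j ↦ 1 - x * Q ^ j), ← prod_mul_distrib]
  refine prod_congr rfl fun j hj ↦ ?_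
  obtain ⟨r, rfl⟩ := Nat.exists_eq_add_of_lt (mem_range.1 hj)
  rw [show j + r + 1 - 1 - j = r by lia]
  ring

end Saalschutz

section Summation

variable {K : Type*} [Field K] {q : K}

/-- The part of the summand that does not depend on the deformation parameter `t`. -/
noncomputable def weight (q : K) (k : ℕ) : K :=
  qPoch q (q ^ 3) k * q ^ (3 * k) / qPoch (q ^ 3) (q ^ 3) k ^ 3

/-- With `t = a + a⁻¹ - 2` this is `(aq; q³)ₖ (q/a; q³)ₖ`. -/
def deformed (q t : K) (k : ℕ) : K :=
  ∏ j ∈ range k, ((1 - q ^ (3 * j + 1)) ^ 2 - t * q ^ (3 * j + 1))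

theorem qPoch_cube_ne_zero (h : ∀ m, 0 < m → 1 - q ^ m ≠ 0) (k : ℕ) :
    qPoch (q ^ 3) (q ^ 3) k ≠ 0 := by
  refine prod_ne_zero_iff.2 fun j _ ↦ ?_
  convert h (3 * j + 3) (by lia) using 1
  ring

theorem weight_zero : weight q 0 = 1 := by simp [weight, qPoch_zero]

theorem weight_succ (k : ℕ) :
    weight q (k + 1) =
      weight q k * (q ^ 3 * (1 - q ^ (3 * k + 1)) / (1 - q ^ (3 * k + 3)) ^ 3) := by
  rw [weight, weight, qPoch_succ, qPoch_succ, mul_pow, ← mul_div_mul_comm,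
    show q ^ 3 * (q ^ 3) ^ k = q ^ (3 * k + 3) by ring]
  congr 1
  ring

theorem sum_saalCoeff_mul_deformed (h : ∀ m, 0 < m → 1 - q ^ m ≠ 0) (t : K) (M : ℕ) :
    ∑ k ∈ range (M + 1), saalCoeff (q ^ 2) (q ^ 3) k (M - k) * deformed q t k =
      q ^ (2 * M) * ∏ j ∈ range M, ((1 - q ^ (3 * j + 2)) ^ 2 - t * q ^ (3 * j + 2)) := by
  have := prod_eq_sum_saalCoeff (qPoch_cube_ne_zero h) (q ^ 2) ((2 + t) * q) M
  rw [Finset.Nat.sum_antidiagonal_eq_sum_range_succ (fun k i ↦ saalCoeff (q ^ 2) (q ^ 3) k i *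
    ∏ j ∈ range k, (1 - (2 + t) * q * (q ^ 3) ^ j + q ^ 2 * (q ^ 3) ^ (2 * j)))] at this
  rw [pow_mul, ← card_range M, ← prod_const, card_range, ← prod_mul_distrib]
  convert this.symm using 2 with k _ j _
  · congr 1
    refine prod_congr rfl fun j _ ↦ ?_
    ring
  · ring

theorem saalCoeff_mul_eq_weight_mul_deformed (hq : q ≠ 0) (h : ∀ m, 0 < m → 1 - q ^ m ≠ 0)
    (M k i : ℕ) (hki : k + i = M) :
    saalCoeff (q ^ (3 * M + 3)) (q ^ 3) k i * ∏ j ∈ range k,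
        (1 - (q + q ^ (3 * M + 2)) * (q ^ 3) ^ j + q ^ (3 * M + 3) * (q ^ 3) ^ (2 * j)) =
      saalCoeff (q ^ (3 * M + 3)) (q ^ 3) 0 M *
        (weight q k * deformed q ((1 - q ^ (3 * M + 1)) ^ 2 / q ^ (3 * M + 1)) k) := by
  induction k generalizing i with
  | zero =>
    rw [zero_add] at hki
    simp [hki, weight_zero, deformed]
  | succ k ih =>
    specialize ih (i + 1) (by lia)
    have hr := saalCoeff_ratio (m := q ^ (3 * M + 3)) (qPoch_cube_ne_zero h) k i
    have h1 : 1 - q ^ (3 * k + 3) ≠ 0 := h _ (by lia)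
    have h2 : (1 - (q ^ 3) ^ (k + 1)) ^ 2 * (q ^ (3 * M + 3) - (q ^ 3) ^ (i + 1)) ≠ 0 := by
      have : (1 - (q ^ 3) ^ (k + 1)) ^ 2 * (q ^ (3 * M + 3) - (q ^ 3) ^ (i + 1)) =
          - q ^ (3 * i + 3) * (1 - q ^ (3 * k + 3)) ^ 3 := by
        rw [← hki]; ring
      rw [this]
      exact mul_ne_zero (neg_ne_zero.2 (pow_ne_zero _ hq)) (pow_ne_zero _ h1)
    refine mul_right_cancel₀ h2 ?_
    rw [prod_range_succ, deformed, prod_range_succ, weight_succ, ← deformed]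
    have key : q ^ 3 * (1 - (q ^ 3) ^ (i + 1)) * (1 - (q + q ^ (3 * M + 2)) * (q ^ 3) ^ k +
          q ^ (3 * M + 3) * (q ^ 3) ^ (2 * k)) =
        q ^ 3 * (1 - q ^ (3 * k + 1)) / (1 - q ^ (3 * k + 3)) ^ 3 *
          ((1 - q ^ (3 * k + 1)) ^ 2 -
            (1 - q ^ (3 * M + 1)) ^ 2 / q ^ (3 * M + 1) * q ^ (3 * k + 1)) *
          ((1 - (q ^ 3) ^ (k + 1)) ^ 2 * (q ^ (3 * M + 3) - (q ^ 3) ^ (i + 1))) := by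
      rw [← hki]
      field_simp
      ring
    linear_combination (∏ j ∈ range k, (1 - (q + q ^ (3 * M + 2)) * (q ^ 3) ^ j +
      q ^ (3 * M + 3) * (q ^ 3) ^ (2 * j))) * (1 - (q + q ^ (3 * M + 2)) * (q ^ 3) ^ k +
      q ^ (3 * M + 3) * (q ^ 3) ^ (2 * k)) * hr + q ^ 3 * (1 - (q ^ 3) ^ (i + 1)) *
      (1 - (q + q ^ (3 * M + 2)) * (q ^ 3) ^ k + q ^ (3 * M + 3) * (q ^ 3) ^ (2 * k)) * ih +
      saalCoeff (q ^ (3 * M + 3)) (q ^ 3) 0 M * weight q k *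
        deformed q ((1 - q ^ (3 * M + 1)) ^ 2 / q ^ (3 * M + 1)) k * key

theorem sum_weight_mul_deformed (hq : q ≠ 0) (h : ∀ m, 0 < m → 1 - q ^ m ≠ 0) (M : ℕ) :
    ∑ k ∈ range (M + 1),
        weight q k * deformed q ((1 - q ^ (3 * M + 1)) ^ 2 / q ^ (3 * M + 1)) k =
      q ^ M * (qPoch (q ^ 2) (q ^ 3) M ^ 2 / qPoch (q ^ 3) (q ^ 3) M ^ 2) := by
  have hQ := qPoch_cube_ne_zero h
  have hs := prod_eq_sum_saalCoeff hQ (q ^ (3 * M + 3)) (q + q ^ (3 * M + 2)) M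
  rw [sum_congr rfl fun x hx ↦
    saalCoeff_mul_eq_weight_mul_deformed hq h M x.1 x.2 (mem_antidiagonal.1 hx),
    Finset.Nat.sum_antidiagonal_eq_sum_range_succ (fun k _ ↦ _ * (weight q k *
      deformed q ((1 - q ^ (3 * M + 1)) ^ 2 / q ^ (3 * M + 1)) k)), ← mul_sum,
    saalCoeff_zero_left hQ] at hs
  have e1 : q ^ (3 * M + 3) = q ^ 3 * (q ^ 3) ^ M := by ring
  have e2 : ∏ j ∈ range M, (q ^ (3 * M + 3) - (q + q ^ (3 * M + 2)) * (q ^ 3) ^ (j + 1) +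
      (q ^ 3) ^ (2 * (j + 1))) = q ^ M * qPoch (q ^ 2) (q ^ 3) M *
        ∏ j ∈ range M, (q ^ 2 * (q ^ 3) ^ M - (q ^ 3) ^ (j + 1)) := by
    have : q ^ M = ∏ j ∈ range M, q := by simp
    rw [this, qPoch, ← prod_mul_distrib, ← prod_mul_distrib]
    refine prod_congr rfl fun j _ ↦ ?_
    ring
  rw [e2, e1, prod_mul_pow_sub_pow, prod_mul_pow_sub_pow] at hs
  have h3 : ∏ j ∈ range M, -(q ^ 3) ^ (j + 1) ≠ 0 :=
    prod_ne_zero_iff.2 fun j _ ↦ neg_ne_zero.2 (pow_ne_zero _ (pow_ne_zero _ hq))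
  have h4 := hQ M
  rw [← mul_div_assoc, eq_div_iff (pow_ne_zero _ h4)]
  refine mul_left_cancel₀ h3 ?_
  linear_combination -hs

end Summation

section Adic

variable {K : Type*} [Field K] {O : Subring K} {π : K}

/-- The multiples of `π ^ k` by elements of `O`. -/
def adic (O : Subring K) (π : K) (k : ℕ) : AddSubgroup K :=
  O.toAddSubgroup.map (AddMonoidHom.mulLeft (π ^ k))

theorem mem_adic {k : ℕ} {x : K} : x ∈ adic O π k ↔ ∃ y ∈ O, π ^ k * y = x := Iff.rfl

theorem mul_mem_adic {a b : ℕ} {x y : K} (hx : x ∈ adic O π a) (hy : y ∈ adic O π b) :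
    x * y ∈ adic O π (a + b) := by
  obtain ⟨x, hx', rfl⟩ := mem_adic.1 hx
  obtain ⟨y, hy', rfl⟩ := mem_adic.1 hy
  refine mem_adic.2 ⟨x * y, mul_mem hx' hy', ?_⟩
  ring

theorem pow_mul_mem_adic {x : K} (k : ℕ) (hx : x ∈ O) : π ^ k * x ∈ adic O π k :=
  mem_adic.2 ⟨x, hx, rfl⟩

theorem mul_mem_adic_left {k : ℕ} {c x : K} (hc : c ∈ O) (hx : x ∈ adic O π k) :
    c * x ∈ adic O π k := by
  obtain ⟨x, hx', rfl⟩ := mem_adic.1 hx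
  refine mem_adic.2 ⟨c * x, mul_mem hc hx', ?_⟩
  ring

theorem adic_le_adic (hπ : π ∈ O) {a b : ℕ} (hab : a ≤ b) : adic O π b ≤ adic O π a := by
  obtain ⟨c, rfl⟩ := Nat.exists_eq_add_of_le hab
  intro x hx
  obtain ⟨x, hx', rfl⟩ := mem_adic.1 hx
  refine mem_adic.2 ⟨π ^ c * x, mul_mem (pow_mem hπ _) hx', ?_⟩
  ring

theorem prod_sub_prod_mem_adic {ι : Type*} {k : ℕ} {s : Finset ι} {f g : ι → K}
    (hf : ∀ i ∈ s, f i ∈ O) (hg : ∀ i ∈ s, g i ∈ O) (hfg : ∀ i ∈ s, f i - g i ∈ adic O π k) :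
    ∏ i ∈ s, f i - ∏ i ∈ s, g i ∈ adic O π k := by
  classical
  induction s using Finset.induction_on with
  | empty => simp
  | insert a s ha ih =>
    simp only [mem_insert, forall_eq_or_imp] at hf hg hfg
    rw [prod_insert ha, prod_insert ha]
    have := add_mem (mul_mem_adic_left (prod_mem hf.2) hfg.1)
      (mul_mem_adic_left hg.1 (ih hf.2 hg.2 hfg.2))
    convert this using 1
    ring

end Adic

section Congruence

variable {K : Type*} [Field K] {O : Subring K} {q : K} {p : ℕ}

/-- `O` behaves like the ring of rational functions in `q` that are regular at the primitive
`n`-th roots of unity. -/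
structure RegularAtRoot (O : Subring K) (q : K) (n : ℕ) : Prop where
  mem : q ∈ O
  inv_mem : q⁻¹ ∈ O
  ne_zero : q ≠ 0
  one_sub_ne_zero : ∀ m, 0 < m → 1 - q ^ m ≠ 0
  one_sub_inv_mem : ∀ m, ¬ n ∣ m → (1 - q ^ m)⁻¹ ∈ O

theorem not_dvd_of_lt_two_mul {n m : ℕ} (hm : 0 < m) (hlt : m < 2 * n) (hne : m ≠ n) :
    ¬ n ∣ m := by
  rintro ⟨c, rfl⟩
  have : c < 2 := by
    by_contra! hc
    nlinarith
  interval_cases c <;> simp_all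

namespace RegularAtRoot

theorem one_sub_mem {n : ℕ} (H : RegularAtRoot O q n) (m : ℕ) : 1 - q ^ m ∈ O :=
  sub_mem (one_mem _) (pow_mem H.mem _)

theorem pow_inv_mem {n : ℕ} (H : RegularAtRoot O q n) (m : ℕ) : (q ^ m)⁻¹ ∈ O := by
  rw [← inv_pow]
  exact pow_mem H.inv_mem _

theorem one_sub_pow_mul_mem {n : ℕ} (H : RegularAtRoot O q n) (c : ℕ) :
    1 - q ^ (n * c) ∈ adic O (1 - q ^ n) 1 := by
  refine mem_adic.2 ⟨∑ i ∈ range c, (q ^ n) ^ i, sum_mem fun i _ ↦ pow_mem (pow_mem H.mem _) _, ?_⟩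
  rw [pow_one, mul_neg_geom_sum, pow_mul]

theorem qPoch_mem {n : ℕ} (H : RegularAtRoot O q n) (a k : ℕ) :
    qPoch (q ^ a) (q ^ 3) k ∈ O :=
  prod_mem fun _ _ ↦ sub_mem (one_mem _) (mul_mem (pow_mem H.mem _) (pow_mem (pow_mem H.mem _) _))

theorem qPoch_inv_mem (H : RegularAtRoot O q (3 * p + 2)) {a k : ℕ} (ha : a % 3 ≠ 2) (ha0 : 0 < a)
    (hk : a + 3 * k ≤ 6 * p + 6) : (qPoch (q ^ a) (q ^ 3) k)⁻¹ ∈ O := by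
  rw [qPoch, ← prod_inv_distrib]
  refine prod_mem fun j hj ↦ ?_
  have hj := mem_range.1 hj
  convert H.one_sub_inv_mem (a + 3 * j) (not_dvd_of_lt_two_mul (by lia) (by lia) (by lia)) using 1
  ring

theorem weight_mem (H : RegularAtRoot O q (3 * p + 2)) {k : ℕ} (hk : k ≤ 2 * p + 1) :
    weight q k ∈ O := by
  rw [weight, div_eq_mul_inv, ← inv_pow]
  have := H.qPoch_mem 1 k
  rw [pow_one] at this
  exact mul_mem (mul_mem this (pow_mem H.mem _))
    (pow_mem (H.qPoch_inv_mem (by simp) (by simp) (by lia)) _)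

theorem saalCoeff_sub_weight_mem (H : RegularAtRoot O q (3 * p + 2)) {k i : ℕ}
    (hki : k + i = 2 * p + 1) :
    saalCoeff (q ^ 2) (q ^ 3) k i - saalCoeff (q ^ 2) (q ^ 3) 0 (2 * p + 1) * weight q k ∈
      adic O (1 - q ^ (3 * p + 2)) 1 := by
  have hQ := qPoch_cube_ne_zero H.one_sub_ne_zero
  have h0 : saalCoeff (q ^ 2) (q ^ 3) 0 (2 * p + 1) ∈ O := by
    rw [saalCoeff_zero_left hQ]
    exact mul_mem (H.qPoch_mem _ _) (prod_mem fun _ _ ↦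
      sub_mem (pow_mem H.mem _) (pow_mem (pow_mem H.mem _) _))
  induction k generalizing i with
  | zero =>
    rw [zero_add] at hki
    simp [hki, weight_zero]
  | succ k ih =>
    specialize ih (i := i + 1) (by lia)
    have hr := saalCoeff_ratio (m := q ^ 2) hQ k i
    have h1 : 1 - q ^ (3 * k + 3) ≠ 0 := H.one_sub_ne_zero _ (by lia)
    have h2 : 1 - q ^ (3 * i + 1) ≠ 0 := H.one_sub_ne_zero _ (by lia)
    have h1' := H.one_sub_inv_mem (3 * k + 3) (not_dvd_of_lt_two_mul (by lia) (by lia) (by lia))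
    have h2' := H.one_sub_inv_mem (3 * i + 1) (not_dvd_of_lt_two_mul (by lia) (by lia) (by lia))
    have hq := H.ne_zero
    set u := q * (1 - q ^ (3 * i + 3)) * ((1 - q ^ (3 * k + 3))⁻¹ ^ 2 * (1 - q ^ (3 * i + 1))⁻¹)
      with hu
    have hu_mem : u ∈ O := mul_mem (mul_mem H.mem (H.one_sub_mem _))
      (mul_mem (pow_mem h1' _) h2')
    have hd : saalCoeff (q ^ 2) (q ^ 3) (k + 1) i = saalCoeff (q ^ 2) (q ^ 3) k (i + 1) * u := by
      have h3 : (1 - (q ^ 3) ^ (k + 1)) ^ 2 * (q ^ 2 - (q ^ 3) ^ (i + 1)) =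
          q ^ 2 * ((1 - q ^ (3 * k + 3)) ^ 2 * (1 - q ^ (3 * i + 1))) := by ring
      rw [h3] at hr
      refine mul_right_cancel₀ (mul_ne_zero (pow_ne_zero 2 hq)
        (mul_ne_zero (pow_ne_zero 2 h1) h2)) (hr.trans ?_)
      rw [hu]
      field_simp
      ring
    have hc : weight q k * (q ^ 3 * (1 - q ^ (3 * k + 1)) / (1 - q ^ (3 * k + 3)) ^ 3) =
        weight q k * u - q * (1 - q ^ 2) * ((1 - q ^ (3 * k + 3))⁻¹ ^ 3 *
          (1 - q ^ (3 * i + 1))⁻¹) * weight q k * (1 - q ^ ((3 * p + 2) * 2)) := by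
      rw [show (3 * p + 2) * 2 = 3 * k + 3 * i + 4 by lia, hu]
      field_simp
      ring
    rw [hd, weight_succ, hc]
    have hw := H.weight_mem (k := k) (by lia)
    have := add_mem (mul_mem_adic_left hu_mem ih) (mul_mem_adic_left (mul_mem h0
      (mul_mem (mul_mem (mul_mem H.mem (H.one_sub_mem 2)) (mul_mem (pow_mem h1' 3) h2')) hw))
      (H.one_sub_pow_mul_mem 2))
    convert this using 1
    ring

theorem deformed_sub_mem {n : ℕ} (H : RegularAtRoot O q n) {π t : K} {a : ℕ} (hπ : π ∈ O)
    (ht : t ∈ adic O π a) (k : ℕ) :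
    deformed q t k - deformed q 0 k ∈ adic O π a := by
  have ht' : t ∈ O := by
    obtain ⟨y, hy, rfl⟩ := mem_adic.1 ht
    exact mul_mem (pow_mem hπ _) hy
  refine prod_sub_prod_mem_adic
    (fun _ _ ↦ sub_mem (pow_mem (H.one_sub_mem _) _) (mul_mem ht' (pow_mem H.mem _)))
    (fun _ _ ↦ sub_mem (pow_mem (H.one_sub_mem _) _) (mul_mem (zero_mem _) (pow_mem H.mem _)))
    fun j _ ↦ ?_
  have := neg_mem (mul_mem_adic_left (pow_mem H.mem (3 * j + 1)) ht)
  convert this using 1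
  ring

/-- The value of the deformation parameter at which the deformed sum terminates naturally. -/
theorem parameter_mem (H : RegularAtRoot O q (3 * p + 2)) :
    (1 - q ^ (6 * p + 4)) ^ 2 / q ^ (6 * p + 4) ∈ adic O (1 - q ^ (3 * p + 2)) 2 := by
  have hq := H.ne_zero
  refine mem_adic.2 ⟨(1 + q ^ (3 * p + 2)) ^ 2 * (q ^ (6 * p + 4))⁻¹,
    mul_mem (pow_mem (add_mem (one_mem _) (pow_mem H.mem _)) _) (H.pow_inv_mem _), ?_⟩
  field_simp
  ring

theorem sum_weight_sub_mem (H : RegularAtRoot O q (3 * p + 2)) {t : K}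
    (ht : t ∈ adic O (1 - q ^ (3 * p + 2)) 2) :
    saalCoeff (q ^ 2) (q ^ 3) 0 (2 * p + 1) *
        (∑ k ∈ range (2 * p + 2), weight q k * deformed q t k -
          ∑ k ∈ range (2 * p + 2), weight q k * deformed q 0 k) -
      (q ^ (2 * (2 * p + 1)) *
          ∏ j ∈ range (2 * p + 1), ((1 - q ^ (3 * j + 2)) ^ 2 - t * q ^ (3 * j + 2)) -
        q ^ (2 * (2 * p + 1)) *
          ∏ j ∈ range (2 * p + 1), ((1 - q ^ (3 * j + 2)) ^ 2 - 0 * q ^ (3 * j + 2))) ∈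
      adic O (1 - q ^ (3 * p + 2)) 3 := by
  rw [← sum_saalCoeff_mul_deformed H.one_sub_ne_zero,
    ← sum_saalCoeff_mul_deformed H.one_sub_ne_zero,
    ← sum_sub_distrib, ← sum_sub_distrib, mul_sum, ← sum_sub_distrib]
  refine sum_mem fun k hk ↦ ?_
  have h1 := H.saalCoeff_sub_weight_mem (k := k) (i := 2 * p + 1 - k)
    (by have := mem_range.1 hk; lia)
  have h2 := neg_mem (mul_mem_adic h1 (H.deformed_sub_mem (H.one_sub_mem _) ht k))
  convert h2 using 1
  ring

theorem prod_add_three_mul_mem (H : RegularAtRoot O q (3 * p + 2)) :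
    ∏ j ∈ range (2 * p + 1), ((1 - q ^ (3 * j + 2)) ^ 2 -
        (1 - q ^ (6 * p + 4)) ^ 2 / q ^ (6 * p + 4) * q ^ (3 * j + 2)) +
      3 * qPoch (q ^ 2) (q ^ 3) (2 * p + 1) ^ 2 ∈ adic O (1 - q ^ (3 * p + 2)) 3 := by
  have hq := H.ne_zero
  set t := (1 - q ^ (6 * p + 4)) ^ 2 / q ^ (6 * p + 4) with ht
  have ht1 : t ∈ adic O (1 - q ^ (3 * p + 2)) 1 :=
    adic_le_adic (H.one_sub_mem _) one_le_two H.parameter_mem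
  have ht0 : t ∈ O := by
    obtain ⟨y, hy, hy'⟩ := mem_adic.1 ht1
    rw [← hy']
    exact mul_mem (pow_mem (H.one_sub_mem _) _) hy
  have hp : p ∈ range (2 * p + 1) := mem_range.2 (by lia)
  have hP : qPoch (q ^ 2) (q ^ 3) (2 * p + 1) ^ 2 =
      ∏ j ∈ range (2 * p + 1), (1 - q ^ (3 * j + 2)) ^ 2 := by
    rw [qPoch, ← prod_pow]
    refine prod_congr rfl fun j _ ↦ ?_
    ring
  have hf (j : ℕ) : (1 - q ^ (3 * j + 2)) ^ 2 ∈ O := pow_mem (H.one_sub_mem _) _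
  have hg (j : ℕ) : (1 - q ^ (3 * j + 2)) ^ 2 - t * q ^ (3 * j + 2) ∈ O :=
    sub_mem (hf j) (mul_mem ht0 (pow_mem H.mem _))
  have hrest := prod_sub_prod_mem_adic (s := (range (2 * p + 1)).erase p)
    (fun j _ ↦ hg j) (fun j _ ↦ hf j) (fun j _ ↦ by
      have := neg_mem (mul_mem_adic_left (pow_mem H.mem (3 * j + 2)) ht1)
      convert this using 1
      ring)
  rw [hP, ← mul_prod_erase _ _ hp, ← mul_prod_erase _ (fun j ↦ (1 - q ^ (3 * j + 2)) ^ 2) hp]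
  set a := ∏ j ∈ (range (2 * p + 1)).erase p, ((1 - q ^ (3 * j + 2)) ^ 2 - t * q ^ (3 * j + 2))
    with ha
  set b := ∏ j ∈ (range (2 * p + 1)).erase p, (1 - q ^ (3 * j + 2)) ^ 2
  have ha_mem : a ∈ O := prod_mem fun j _ ↦ hg j
  have hdouble : (1 - q ^ (3 * p + 2)) ^ 2 - t * q ^ (3 * p + 2) =
      (1 - q ^ (3 * p + 2)) ^ 2 * (-3 - (1 - q ^ (3 * p + 2)) ^ 2 * (q ^ (3 * p + 2))⁻¹) := by
    rw [ht]
    field_simp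
    ring
  have h1 := mul_mem_adic (pow_mul_mem_adic (π := 1 - q ^ (3 * p + 2)) 2 (one_mem O)) hrest
  have h2 := pow_mul_mem_adic (π := 1 - q ^ (3 * p + 2)) 3
    (mul_mem (mul_mem (H.one_sub_mem (3 * p + 2)) (H.pow_inv_mem (3 * p + 2))) ha_mem)
  have := sub_mem (mul_mem_adic_left (neg_mem (natCast_mem O 3)) h1) h2
  rw [hdouble]
  convert this using 1
  push_cast
  ring

theorem qPoch_add_qPoch_mem (H : RegularAtRoot O q (3 * p + 2)) :
    q ^ (2 * p + 1) * qPoch q (q ^ 3) (2 * p + 1) + qPoch (q ^ 3) (q ^ 3) (2 * p + 1) ∈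
      adic O (1 - q ^ (3 * p + 2)) 1 := by
  have hprod : ∏ j ∈ range (2 * p + 1), q ^ (3 * j + 1) = q ^ ((2 * p + 1) * (3 * p + 1)) := by
    have hsum (r : ℕ) : ∑ j ∈ range (2 * r + 1), (3 * j + 1) = (2 * r + 1) * (3 * r + 1) := by
      induction r with
      | zero => rfl
      | succ r ih =>
        rw [show 2 * (r + 1) + 1 = 2 * r + 1 + 1 + 1 by ring, sum_range_succ, sum_range_succ, ih]
        ring
    rw [prod_pow_eq_pow_sum, hsum]
  have hrefl : qPoch (q ^ 3) (q ^ 3) (2 * p + 1) =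
      ∏ j ∈ range (2 * p + 1), (1 - q ^ (3 * (2 * p + 1 - j))) := by
    rw [qPoch, ← prod_range_reflect]
    refine prod_congr rfl fun j hj ↦ ?_
    have hj := mem_range.1 hj
    rw [← pow_mul, ← pow_add, show 3 + 3 * (2 * p + 1 - 1 - j) = 3 * (2 * p + 1 - j) by lia]
  have hneg : qPoch q (q ^ 3) (2 * p + 1) =
      -∏ j ∈ range (2 * p + 1), (-(1 - q ^ (3 * j + 1))) := by
    rw [prod_neg, card_range, Odd.neg_one_pow ⟨p, rfl⟩, neg_one_mul, neg_neg, qPoch]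
    refine prod_congr rfl fun j _ ↦ ?_
    ring
  have hcong : ∏ j ∈ range (2 * p + 1), (q ^ (3 * j + 1) * (1 - q ^ (3 * (2 * p + 1 - j)))) -
      ∏ j ∈ range (2 * p + 1), (-(1 - q ^ (3 * j + 1))) ∈ adic O (1 - q ^ (3 * p + 2)) 1 := by
    refine prod_sub_prod_mem_adic (fun j _ ↦ mul_mem (pow_mem H.mem _) (H.one_sub_mem _))
      (fun j _ ↦ neg_mem (H.one_sub_mem _)) fun j hj ↦ ?_
    have hj := mem_range.1 hj
    convert H.one_sub_pow_mul_mem 2 using 1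
    rw [show (3 * p + 2) * 2 = 3 * j + 1 + 3 * (2 * p + 1 - j) by lia]
    ring
  rw [prod_mul_distrib, hprod, ← hrefl] at hcong
  have := add_mem (mul_mem_adic_left (pow_mem H.mem (2 * p + 1)) hcong)
    (mul_mem_adic_left (H.qPoch_mem 3 (2 * p + 1)) (H.one_sub_pow_mul_mem (2 * p + 1)))
  convert this using 1
  rw [hneg]
  ring

end RegularAtRoot

end Congruence

section Main

namespace RegularAtRoot

variable {K : Type*} [Field K] {O : Subring K} {q : K} {p : ℕ}

theorem qPoch_sq_mem (H : RegularAtRoot O q (3 * p + 2)) :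
    qPoch (q ^ 2) (q ^ 3) (2 * p + 1) ^ 2 ∈ adic O (1 - q ^ (3 * p + 2)) 2 := by
  have hp : p ∈ range (2 * p + 1) := mem_range.2 (by lia)
  rw [qPoch, ← mul_prod_erase _ _ hp, mul_pow,
    show q ^ 2 * (q ^ 3) ^ p = q ^ (3 * p + 2) by ring]
  exact pow_mul_mem_adic 2 (pow_mem (prod_mem fun j _ ↦ sub_mem (one_mem _)
    (mul_mem (pow_mem H.mem _) (pow_mem (pow_mem H.mem _) _))) _)

theorem sum_weight_add_mem (H : RegularAtRoot O q (3 * p + 2)) :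
    ∑ k ∈ range (2 * p + 2), weight q k * deformed q 0 k +
        3 * (q ^ (2 * p + 1) * (qPoch (q ^ 2) (q ^ 3) (2 * p + 1) ^ 2 /
          qPoch (q ^ 3) (q ^ 3) (2 * p + 1) ^ 2)) ∈ adic O (1 - q ^ (3 * p + 2)) 3 := by
  have hq := H.ne_zero
  have hQ := qPoch_cube_ne_zero H.one_sub_ne_zero
  have hQM := hQ (2 * p + 1)
  have hA : qPoch q (q ^ 3) (2 * p + 1) ≠ 0 := by
    refine prod_ne_zero_iff.2 fun j _ ↦ ?_
    convert H.one_sub_ne_zero (3 * j + 1) (by lia) using 1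
    ring
  have hQinv := H.qPoch_inv_mem (a := 3) (k := 2 * p + 1) (by simp) (by simp) (by lia)
  have hAinv := H.qPoch_inv_mem (a := 1) (k := 2 * p + 1) (by simp) (by simp) (by lia)
  rw [pow_one] at hAinv
  have hC : saalCoeff (q ^ 2) (q ^ 3) 0 (2 * p + 1) = qPoch (q ^ 3) (q ^ 3) (2 * p + 1) *
      (q ^ (2 * (2 * p + 1)) * qPoch q (q ^ 3) (2 * p + 1)) := by
    rw [saalCoeff_zero_left hQ, pow_mul, ← card_range (2 * p + 1), ← prod_const, card_range,
      qPoch.eq_def q, ← prod_mul_distrib]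
    congr 1
    refine prod_congr rfl fun j _ ↦ ?_
    ring
  have hP : ∏ j ∈ range (2 * p + 1), ((1 - q ^ (3 * j + 2)) ^ 2 - 0 * q ^ (3 * j + 2)) =
      qPoch (q ^ 2) (q ^ 3) (2 * p + 1) ^ 2 := by
    rw [qPoch, ← prod_pow]
    refine prod_congr rfl fun j _ ↦ ?_
    ring
  have h1 := H.sum_weight_sub_mem H.parameter_mem
  have h2 := H.prod_add_three_mul_mem
  have h3 := mul_mem_adic H.qPoch_sq_mem H.qPoch_add_qPoch_mem
  have h4 := sum_weight_mul_deformed hq H.one_sub_ne_zero (2 * p + 1)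
  rw [show 3 * (2 * p + 1) + 1 = 6 * p + 4 by ring, show 2 * p + 1 + 1 = 2 * p + 2 by ring] at h4
  rw [h4, hP, hC] at h1
  have hqi := H.pow_inv_mem (2 * (2 * p + 1))
  have := add_mem (neg_mem (mul_mem_adic_left (mul_mem (mul_mem hQinv hAinv) hqi) h1))
    (add_mem (neg_mem (mul_mem_adic_left (mul_mem hQinv hAinv) h2))
      (mul_mem_adic_left (mul_mem (natCast_mem O 4) (mul_mem (pow_mem hQinv 2) hAinv)) h3))
  convert this using 1
  push_cast
  field_simp
  ring_nf

theorem sum_sub_four_mem (H : RegularAtRoot O q (3 * p + 2)) :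
    ((1 - q ^ (2 * (3 * p + 2))) / (1 - q)) ^ 2 * ∑ i ∈ Icc 1 (2 * p + 1),
        q ^ (3 * i - 1) / ((1 - q ^ (3 * i - 1)) / (1 - q)) ^ 2 - 4 ∈
      adic O (1 - q ^ (3 * p + 2)) 1 := by
  have h1 : 1 - q ≠ 0 := by simpa using H.one_sub_ne_zero 1 one_pos
  have hp : p + 1 ∈ Icc 1 (2 * p + 1) := mem_Icc.2 (by lia)
  rw [mul_sum, ← add_sum_erase _ _ hp, add_sub_right_comm]
  refine add_mem ?_ (sum_mem fun i hi ↦ ?_)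
  · have hn := H.one_sub_ne_zero (3 * p + 2) (by lia)
    rw [show 3 * (p + 1) - 1 = 3 * p + 2 by lia]
    refine mem_adic.2 ⟨-((q ^ (3 * p + 2)) ^ 2 + 3 * q ^ (3 * p + 2) + 4), neg_mem (add_mem
      (add_mem (pow_mem (pow_mem H.mem _) _) (mul_mem (natCast_mem O 3) (pow_mem H.mem _)))
      (natCast_mem O 4)), ?_⟩
    rw [show 2 * (3 * p + 2) = (3 * p + 2) * 2 by ring, pow_mul]
    generalize q ^ (3 * p + 2) = x at hn ⊢
    field_simp
    ring
  · rw [mem_erase, mem_Icc] at hi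
    have hm := H.one_sub_ne_zero (3 * i - 1) (by lia)
    have hm' := H.one_sub_inv_mem (3 * i - 1)
      (not_dvd_of_lt_two_mul (by lia) (by lia) (by lia))
    have := mul_mem_adic_left (mul_mem (mul_mem (H.one_sub_mem ((3 * p + 2) * 2))
      (pow_mem H.mem (3 * i - 1))) (pow_mem hm' 2)) (H.one_sub_pow_mul_mem 2)
    convert this using 1
    rw [mul_comm 2 (3 * p + 2)]
    field_simp

theorem sum_sub_mem (H : RegularAtRoot O q (3 * p + 2)) :
    ∑ k ∈ range (2 * p + 2),
          qPoch q (q ^ 3) k ^ 3 / qPoch (q ^ 3) (q ^ 3) k ^ 3 * q ^ (3 * k) -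
        q ^ (2 * p + 1) * (qPoch (q ^ 2) (q ^ 3) (2 * p + 1) ^ 2 /
          qPoch (q ^ 3) (q ^ 3) (2 * p + 1) ^ 2) *
        (1 - ((1 - q ^ (2 * (3 * p + 2))) / (1 - q)) ^ 2 * ∑ i ∈ Icc 1 (2 * p + 1),
          q ^ (3 * i - 1) / ((1 - q ^ (3 * i - 1)) / (1 - q)) ^ 2) ∈
      adic O (1 - q ^ (3 * p + 2)) 3 := by
  have hterm (k : ℕ) : qPoch q (q ^ 3) k ^ 3 / qPoch (q ^ 3) (q ^ 3) k ^ 3 * q ^ (3 * k) =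
      weight q k * deformed q 0 k := by
    have : deformed q 0 k = qPoch q (q ^ 3) k ^ 2 := by
      rw [deformed, qPoch, ← prod_pow]
      refine prod_congr rfl fun j _ ↦ ?_
      ring
    rw [this, weight]
    ring
  rw [sum_congr rfl fun k _ ↦ hterm k]
  have hQinv := H.qPoch_inv_mem (a := 3) (k := 2 * p + 1) (by simp) (by simp) (by lia)
  have := add_mem H.sum_weight_add_mem (mul_mem_adic_left
    (mul_mem (pow_mem H.mem (2 * p + 1)) (pow_mem hQinv 2))
    (mul_mem_adic H.qPoch_sq_mem H.sum_sub_four_mem))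
  convert this using 1
  rw [div_eq_mul_inv, inv_pow]
  ring

end RegularAtRoot

open Polynomial in
/-- The rational functions whose denominator is not divisible by the prime `P`. -/
noncomputable def regularSubring {P : ℚ[X]} (hP : Prime P) : Subring (RatFunc ℚ) where
  carrier := {f | ∃ r s : ℚ[X], ¬ P ∣ s ∧ f = algebraMap _ _ r / algebraMap _ _ s}
  zero_mem' := ⟨0, 1, hP.not_dvd_one, by simp⟩
  one_mem' := ⟨1, 1, hP.not_dvd_one, by simp⟩
  neg_mem' := by
    rintro _ ⟨r, s, hs, rfl⟩
    exact ⟨-r, s, hs, by rw [map_neg, neg_div]⟩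
  mul_mem' := by
    rintro _ _ ⟨r, s, hs, rfl⟩ ⟨r', s', hs', rfl⟩
    exact ⟨r * r', s * s', hP.not_dvd_mul hs hs', by rw [map_mul, map_mul, div_mul_div_comm]⟩
  add_mem' := by
    rintro _ _ ⟨r, s, hs, rfl⟩ ⟨r', s', hs', rfl⟩
    refine ⟨r * s' + s * r', s * s', hP.not_dvd_mul hs hs', ?_⟩
    have hne {s : ℚ[X]} (hs : ¬ P ∣ s) : algebraMap ℚ[X] (RatFunc ℚ) s ≠ 0 :=
      RatFunc.algebraMap_ne_zero fun h ↦ hs (h ▸ dvd_zero P)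
    rw [div_add_div _ _ (hne hs) (hne hs')]
    simp only [map_add, map_mul]

open Polynomial in
theorem dvd_of_cyclotomic_dvd_one_sub_X_pow {n m : ℕ} (hn : 0 < n)
    (h : cyclotomic n ℚ ∣ 1 - X ^ m) : n ∣ m := by
  have hζ := Complex.isPrimitiveRoot_exp n hn.ne'
  refine (hζ.pow_eq_one_iff_dvd m).1 ?_
  obtain ⟨r, hr⟩ := h
  have h0 : aeval (Complex.exp (2 * Real.pi * Complex.I / n)) (cyclotomic n ℚ) = 0 := by
    rw [aeval_def, ← eval_map, map_cyclotomic]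
    exact hζ.isRoot_cyclotomic hn
  have := congr_arg (aeval (Complex.exp (2 * Real.pi * Complex.I / n))) hr
  rw [map_mul, h0, zero_mul, map_sub, map_one, map_pow, aeval_X, sub_eq_zero] at this
  exact this.symm

open Polynomial in
theorem regularAtRoot_regularSubring {n : ℕ} (hn : 1 < n) (hP : Prime (cyclotomic n ℚ)) :
    RegularAtRoot (regularSubring hP) RatFunc.X n where
  mem := ⟨X, 1, hP.not_dvd_one, by simp⟩
  inv_mem := by
    refine ⟨1, X, fun h ↦ hP.not_dvd_one ?_, by simp⟩
    have h1 := cyclotomic.dvd_X_pow_sub_one n ℚ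
    have h2 := dvd_sub (h.trans (dvd_pow_self X (show n ≠ 0 by lia))) h1
    simpa using h2
  ne_zero := RatFunc.X_ne_zero
  one_sub_ne_zero m hm := by
    have : (1 - X ^ m : ℚ[X]) ≠ 0 := by
      rw [← neg_sub]
      exact neg_ne_zero.2 (X_pow_sub_C_ne_zero hm 1)
    simpa using RatFunc.algebraMap_ne_zero this
  one_sub_inv_mem m hm :=
    ⟨1, 1 - X ^ m, fun h ↦ hm (dvd_of_cyclotomic_dvd_one_sub_X_pow (by lia) h), by simp⟩

end Main

theorem stmt1 (n : ℕ) (hn : 0 < n) (hmod : n % 3 = 2) :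
    ratCongr
      (∑ k ∈ Finset.range ((2 * n - 1) / 3 + 1),
        qPoch RatFunc.X (RatFunc.X ^ 3) k ^ 3 /
          qPoch (RatFunc.X ^ 3) (RatFunc.X ^ 3) k ^ 3 * RatFunc.X ^ (3 * k))
      (RatFunc.X ^ ((2 * n - 1) / 3) *
        (qPoch (RatFunc.X ^ 2) (RatFunc.X ^ 3) ((2 * n - 1) / 3) ^ 2 /
          qPoch (RatFunc.X ^ 3) (RatFunc.X ^ 3) ((2 * n - 1) / 3) ^ 2) *
        (1 - qint (2 * n) ^ 2 *
          ∑ i ∈ Finset.Icc 1 ((2 * n - 1) / 3),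
            RatFunc.X ^ (3 * i - 1) / qint (3 * i - 1) ^ 2))
      ((Polynomial.cyclotomic n ℚ) ^ 3) := by
  have hirr := Polynomial.cyclotomic.irreducible_rat hn
  obtain ⟨p, rfl⟩ : ∃ p, n = 3 * p + 2 := ⟨n / 3, by lia⟩
  rw [show (2 * (3 * p + 2) - 1) / 3 = 2 * p + 1 by lia]
  obtain ⟨_, ⟨r, s, hs, rfl⟩, h⟩ :=
    mem_adic.1 (regularAtRoot_regularSubring (by lia) hirr.prime).sum_sub_mem
  obtain ⟨c, hc⟩ := Polynomial.cyclotomic.dvd_X_pow_sub_one (3 * p + 2) ℚ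
  refine ⟨-c ^ 3 * r, s, fun h0 ↦ hs (h0 ▸ dvd_zero _),
    ((hirr.isRelPrime_iff_not_dvd.2 hs).symm).pow_right, h.symm.trans ?_⟩
  have hX : (1 - RatFunc.X ^ (3 * p + 2) : RatFunc ℚ) =
      -algebraMap (Polynomial ℚ) (RatFunc ℚ) (Polynomial.cyclotomic (3 * p + 2) ℚ * c) := by
    rw [← hc]
    simp
  rw [hX]
  simp only [map_mul, map_neg, map_pow]
  ring
end

section
/- Let p be an odd prime with p ≡ t (mod 3), where t ∈ {1, 2}. Then Σ_{k=0}^{(tp-1)/3} ((1/3)_k^3 / k!^3) ≡ ((2/3)_{(tp-1)/3}^2 / (1)_{(tp-1)/3}^2) · { 1 + (−1)^{t−1} (tp)^2 Σ_{i=1}^{(tp-1)/3} 1/(3i−1)^2 } (mod p^3), i.e., the difference of these two rational numbers has p-adic valuation at least 3. -/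
open Finset

/-- The shifted factorial (Pochhammer symbol) `(x)_k = x(x+1)⋯(x+k-1)` for `x : ℚ`. -/
noncomputable def rpoch (x : ℚ) (k : ℕ) : ℚ :=
  ∏ i ∈ Finset.range k, (x + i)

/-- `A ≡ B (mod p^3)` for rational numbers: the denominator of `A - B` (in lowest terms)
is coprime to `p` and the numerator is divisible by `p^3`. -/
def ratCongrPcubed (p : ℕ) (A B : ℚ) : Prop :=
  ¬ (p ∣ (A - B).den) ∧ ((p : ℤ)) ^ 3 ∣ (A - B).num

/-- Partial sums of the creative-telescoping relation in `n` behind the balanced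
`₃F₂(-n, a, n + 1 - a; 1, 1; 1)`, where `a + b = n + 1`. -/
theorem sum_saalschutz_telescope {K : Type*} [Field K] [CharZero K] (n : ℕ) (a b : K)
    (hab : a + b = n + 1) (k : ℕ) :
    ∑ i ∈ range (k + 1),
      ((n + 1 : K) ^ 2 * ((-1) ^ i * ((n + 1).choose i : K) * (∏ j ∈ range i, (a + j)) *
          (∏ j ∈ range i, (b + 1 + j)) / (i.factorial : K) ^ 2) -
        b ^ 2 * ((-1) ^ i * (n.choose i : K) * (∏ j ∈ range i, (a + j)) *
          (∏ j ∈ range i, (b + j)) / (i.factorial : K) ^ 2)) =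
      (n + 1 + b) * ((-1) ^ k * (n.choose k : K) * (∏ j ∈ range (k + 1), (a + j)) *
        (∏ j ∈ range k, (b + 1 + j)) / (k.factorial : K) ^ 2) := by
  induction k with
  | zero =>
    simp only [zero_add, sum_range_one, prod_range_one, prod_range_zero, Nat.choose_zero_right,
      Nat.factorial_zero, Nat.cast_one, Nat.cast_zero, pow_zero]
    rw [← hab]; ring
  | succ k ih =>
    rw [sum_range_succ, ih]
    have hb : ∏ j ∈ range (k + 1), (b + j) = b * ∏ j ∈ range k, (b + 1 + j) := by
      rw [prod_range_succ', mul_comm]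
      congr 1
      · simp
      · exact prod_congr rfl fun j _ => by push_cast; ring
    have hc : ((n.choose (k + 1) : ℕ) : K) * (k + 1) = n.choose k * (n - k) := by
      rcases le_or_gt k n with h | h
      · have := Nat.choose_succ_right_eq n k
        have h2 := congrArg (Nat.cast : ℕ → K) this
        push_cast [Nat.cast_sub h] at h2
        exact h2
      · simp [Nat.choose_eq_zero_of_lt h, Nat.choose_eq_zero_of_lt (Nat.lt_succ_of_lt h)]
    have hk : (k + 1 : K) ≠ 0 := Nat.cast_add_one_ne_zero k
    have hf : (k.factorial : K) ≠ 0 := Nat.cast_ne_zero.2 k.factorial_ne_zero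
    have hn : (n : K) = a + b - 1 := by rw [hab]; ring
    have hc' : ((n.choose (k + 1) : ℕ) : K) = n.choose k * (n - k) / (k + 1) := by
      rw [eq_div_iff hk, hc]
    rw [hb, prod_range_succ (fun j : ℕ => a + (j : K)) (k + 1),
      prod_range_succ (fun j : ℕ => b + 1 + (j : K)) k, Nat.choose_succ_succ', Nat.factorial_succ]
    push_cast
    rw [hc', hn]
    field_simp
    ring

/-- A special case of the Pfaff–Saalschütz summation. -/
theorem sum_saalschutz {K : Type*} [Field K] [CharZero K] (n : ℕ) (a : K) :
    ∑ i ∈ range (n + 1), (-1) ^ i * (n.choose i : K) * (∏ j ∈ range i, (a + j)) *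
      (∏ j ∈ range i, (n + 1 - a + j)) / (i.factorial : K) ^ 2 =
      ((∏ j ∈ range n, (1 - a + j)) / n.factorial) ^ 2 := by
  induction n with
  | zero => simp
  | succ n ih =>
    have h := sum_saalschutz_telescope n a (n + 1 - a) (by ring) (n + 1)
    rw [sum_sub_distrib, ← mul_sum, ← mul_sum, sum_range_succ _ (n + 1), sum_range_succ _ (n + 1),
      Nat.choose_succ_self, ← sum_range_succ] at h
    simp only [Nat.cast_zero, mul_zero, zero_mul, zero_div, add_zero, ih, sub_eq_zero] at h
    have hn : (n + 1 : K) ≠ 0 := Nat.cast_add_one_ne_zero n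
    have hf : (n.factorial : K) ≠ 0 := Nat.cast_ne_zero.2 n.factorial_ne_zero
    rw [prod_range_succ, Nat.factorial_succ]
    push_cast
    rw [← mul_right_inj' (pow_ne_zero 2 hn)]
    convert h using 1
    · congr 1
      refine sum_congr rfl fun i _ => ?_
      congr 2
      exact prod_congr rfl fun j _ => by ring
    · field_simp
      ring

/-- `sum_saalschutz` in terms of the product `m` of the two parameters with sum `n + 1`. -/
theorem sum_saalschutz_mul (n : ℕ) (m : ℚ) :
    ∑ i ∈ range (n + 1), (-1) ^ i * (n.choose i : ℚ) *
      (∏ j ∈ range i, (m + j * (n + 1 + j))) / (i.factorial : ℚ) ^ 2 =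
      (-1) ^ n * (∏ j ∈ range n, (m - (j + 1) * (n - j))) / (n.factorial : ℚ) ^ 2 := by
  obtain ⟨d, hd⟩ := IsAlgClosed.exists_pow_nat_eq (((n : ℂ) + 1) ^ 2 - 4 * m) two_pos
  obtain ⟨a, ha⟩ : ∃ a : ℂ, a * (n + 1 - a) = m := ⟨(n + 1 + d) / 2, by linear_combination -hd / 4⟩
  have h := sum_saalschutz n a
  have hrefl : ∏ j ∈ range n, (1 - a + j) = ∏ j ∈ range n, ((n : ℂ) - a - j) := by
    rw [← prod_range_reflect]
    refine prod_congr rfl fun j hj => ?_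
    have hj' : j + 1 ≤ n := mem_range.1 hj
    rw [show n - 1 - j = n - (j + 1) by omega, Nat.cast_sub hj']
    push_cast; ring
  rw [div_pow, sq (∏ j ∈ range n, _)] at h
  nth_rewrite 2 [hrefl] at h
  rw [← prod_mul_distrib] at h
  apply (Rat.cast_injective (α := ℂ))
  push_cast
  convert h using 1
  · refine sum_congr rfl fun i _ => ?_
    rw [mul_assoc (_ * _), ← prod_mul_distrib]
    congr 2
    exact prod_congr rfl fun j _ => by rw [← ha]; ring
  · congr 1
    have : (-1 : ℂ) ^ n = ∏ _j ∈ range n, (-1) := by simp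
    rw [this, ← prod_mul_distrib]
    exact prod_congr rfl fun j _ => by rw [← ha]; ring

theorem neg_one_pow_mul_choose_mul_factorial (n k : ℕ) :
    (-1 : ℚ) ^ k * n.choose k * k.factorial = ∏ j ∈ range k, (-(n : ℚ) + j) := by
  induction k with
  | zero => simp
  | succ k ih =>
    rw [prod_range_succ, ← ih, Nat.factorial_succ]
    have hc : ((n.choose (k + 1) : ℕ) : ℚ) * (k + 1) = n.choose k * (n - k) := by
      rcases le_or_gt k n with h | h
      · have h2 := congrArg (Nat.cast : ℕ → ℚ) (Nat.choose_succ_right_eq n k)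
        push_cast [Nat.cast_sub h] at h2
        exact h2
      · simp [Nat.choose_eq_zero_of_lt h, Nat.choose_eq_zero_of_lt (Nat.lt_succ_of_lt h)]
    push_cast
    linear_combination (-1 : ℚ) ^ (k + 1) * k.factorial * hc

/-- Perturbing the cubes `(1/3 + j)³` by `N³/27`, where `N = 3 n + 1`, makes the sum closed form. -/
theorem sum_prod_cube_sub (n : ℕ) (N : ℚ) (hN : N = 3 * n + 1) :
    ∑ k ∈ range (n + 1), (∏ j ∈ range k, ((1 / 3 + (j : ℚ)) ^ 3 + N ^ 3 * (-1 / 27))) /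
      (k.factorial : ℚ) ^ 3 =
      (-1) ^ n * (∏ j ∈ range n, (((3 * j + 2) * (3 * j + 2 - N) + N ^ 2) * (1 / 9))) /
        (n.factorial : ℚ) ^ 2 := by
  convert sum_saalschutz_mul n ((1 + N + N ^ 2) / 9) using 1
  · refine sum_congr rfl fun k _ => ?_
    have hf : (k.factorial : ℚ) ≠ 0 := Nat.cast_ne_zero.2 k.factorial_ne_zero
    have h : ∏ j ∈ range k, ((1 / 3 + (j : ℚ)) ^ 3 + N ^ 3 * (-1 / 27)) =
        (∏ j ∈ range k, (-(n : ℚ) + j)) *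
          ∏ j ∈ range k, ((1 + N + N ^ 2) / 9 + j * (n + 1 + j)) := by
      rw [← prod_mul_distrib]
      exact prod_congr rfl fun j _ => by rw [hN]; ring
    rw [h, ← neg_one_pow_mul_choose_mul_factorial]
    field_simp
  · congr 2
    exact prod_congr rfl fun j _ => by rw [hN]; ring

theorem rpoch_two_thirds_sq (n : ℕ) (N : ℚ) (hN : N = 3 * n + 1) :
    rpoch (2 / 3) n ^ 2 =
      (-1) ^ n * ∏ j ∈ range n, ((3 * j + 2 : ℚ) * (3 * j + 2 - N) * (1 / 9)) := by
  have hrefl : rpoch (2 / 3) n = ∏ j ∈ range n, ((n : ℚ) - 1 / 3 - j) := by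
    rw [rpoch, ← prod_range_reflect]
    refine prod_congr rfl fun j hj => ?_
    have hj' : j + 1 ≤ n := mem_range.1 hj
    rw [show n - 1 - j = n - (j + 1) by omega, Nat.cast_sub hj']
    push_cast; ring
  have : (-1 : ℚ) ^ n = ∏ _j ∈ range n, (-1) := by simp
  rw [sq]
  nth_rewrite 2 [hrefl]
  rw [rpoch, this, ← prod_mul_distrib, ← prod_mul_distrib]
  exact prod_congr rfl fun j _ => by rw [hN]; ring

theorem rpoch_one (n : ℕ) : rpoch 1 n = n.factorial := by
  induction n with
  | zero => simp [rpoch]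
  | succ n ih =>
    rw [rpoch, prod_range_succ, ← rpoch, ih, Nat.factorial_succ]
    push_cast; ring

/-- The rational numbers that are integral at the prime `p`. -/
noncomputable def ratIntegralAt (p : ℕ) [Fact p.Prime] : Subring ℚ :=
  (PadicInt.subring p).comap (Rat.castHom ℚ_[p])

section

variable {p : ℕ} [Fact p.Prime]

theorem mem_ratIntegralAt_iff {x : ℚ} : x ∈ ratIntegralAt p ↔ ¬ p ∣ x.den := by
  rw [← Rat.padicValuation_le_one_iff]
  exact Padic.norm_rat_le_one_iff_padicValuation_le_one p

theorem inv_natCast_mem_ratIntegralAt {d : ℕ} (hd : ¬ p ∣ d) : (d : ℚ)⁻¹ ∈ ratIntegralAt p := by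
  rw [mem_ratIntegralAt_iff]
  have h0 : d ≠ 0 := by rintro rfl; simp at hd
  simpa [h0] using hd

theorem ratCongrPcubed_of_sub_eq {A B w : ℚ} (hw : w ∈ ratIntegralAt p)
    (h : A - B = (p : ℚ) ^ 3 * w) : ratCongrPcubed p A B := by
  rw [mem_ratIntegralAt_iff] at hw
  have hp : p.Prime := Fact.out
  have hmem : A - B ∈ ratIntegralAt p :=
    h ▸ mul_mem (pow_mem (natCast_mem _ _) _) (mem_ratIntegralAt_iff.2 hw)
  refine ⟨mem_ratIntegralAt_iff.1 hmem, ?_⟩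
  have h1 : (A - B).num * (w.den : ℤ) = (p : ℤ) ^ 3 * (w.num * (A - B).den) := by
    have e1 := Rat.mul_den_eq_num (A - B)
    have e2 := Rat.mul_den_eq_num w
    have : ((A - B).num : ℚ) * w.den = (p : ℚ) ^ 3 * (w.num * (A - B).den) := by
      rw [← e1, ← e2, h]; ring
    exact_mod_cast this
  have hcop : IsCoprime ((p : ℤ) ^ 3) (w.den : ℤ) := by
    apply IsCoprime.pow_left
    exact Nat.isCoprime_iff_coprime.2 ((Nat.Prime.coprime_iff_not_dvd hp).2 hw)
  exact hcop.dvd_of_dvd_mul_right ⟨_, h1⟩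

end

theorem Subring.exists_prod_add_mul_eq {A ι : Type*} [CommRing A] (R : Subring A) {c : A}
    (hc : c ∈ R) (s : Finset ι) (u v : ι → A) (hu : ∀ i ∈ s, u i ∈ R) (hv : ∀ i ∈ s, v i ∈ R) :
    ∃ w ∈ R, ∏ i ∈ s, (u i + c * v i) = ∏ i ∈ s, u i + c * w := by
  classical
  induction s using Finset.induction_on with
  | empty => exact ⟨0, zero_mem _, by simp⟩
  | insert a s ha ih =>
    obtain ⟨w, hw, h⟩ := ih (fun i hi => hu i (mem_insert_of_mem hi))
      (fun i hi => hv i (mem_insert_of_mem hi))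
    have hua := hu a (mem_insert_self a s)
    have hva := hv a (mem_insert_self a s)
    have hP : ∏ i ∈ s, u i ∈ R := prod_mem fun i hi => hu i (mem_insert_of_mem hi)
    refine ⟨u a * w + v a * (∏ i ∈ s, u i + c * w),
      add_mem (mul_mem hua hw) (mul_mem hva (add_mem hP (mul_mem hc hw))), ?_⟩
    rw [prod_insert ha, prod_insert ha, h]
    ring

/-- The case in which all `y i` are units of `R`. -/
theorem Subring.exists_prod_mul_sub_add_sq_eq {K ι : Type*} [Field K] (R : Subring K) {c e : K}
    (hc : c ∈ R) (he : e ∈ R) (s : Finset ι) (y : ι → K) (hy : ∀ i ∈ s, y i ∈ R)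
    (hy0 : ∀ i ∈ s, y i ≠ 0) (hy' : ∀ i ∈ s, (y i)⁻¹ ∈ R) :
    ∃ w ∈ R, ∏ i ∈ s, ((y i * (y i - c) + c ^ 2) * e) =
      (∏ i ∈ s, (y i * (y i - c) * e)) * (1 + c ^ 2 * ∑ i ∈ s, 1 / y i ^ 2) + c ^ 3 * w := by
  classical
  induction s using Finset.induction_on with
  | empty => exact ⟨0, zero_mem _, by simp⟩
  | insert a s ha ih =>
    obtain ⟨w, hw, h⟩ := ih (fun i hi => hy i (mem_insert_of_mem hi))
      (fun i hi => hy0 i (mem_insert_of_mem hi)) (fun i hi => hy' i (mem_insert_of_mem hi))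
    have hya := hy a (mem_insert_self a s)
    have hya0 := hy0 a (mem_insert_self a s)
    have hya' := hy' a (mem_insert_self a s)
    have hP : ∏ i ∈ s, (y i * (y i - c) * e) ∈ R := prod_mem fun i hi =>
      mul_mem (mul_mem (hy i (mem_insert_of_mem hi))
        (sub_mem (hy i (mem_insert_of_mem hi)) hc)) he
    have hS : ∑ i ∈ s, 1 / y i ^ 2 ∈ R := sum_mem fun i hi => by
      rw [one_div, ← inv_pow]
      exact pow_mem (hy' i (mem_insert_of_mem hi)) 2
    refine ⟨(∏ i ∈ s, (y i * (y i - c) * e)) * e * ((y a)⁻¹ + c * ∑ i ∈ s, 1 / y i ^ 2) +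
        w * ((y a * (y a - c) + c ^ 2) * e),
      add_mem (mul_mem (mul_mem hP he) (add_mem hya' (mul_mem hc hS)))
        (mul_mem hw (mul_mem (add_mem (mul_mem hya (sub_mem hya hc)) (pow_mem hc 2)) he)), ?_⟩
    rw [prod_insert ha, prod_insert ha, sum_insert ha, h]
    field_simp
    ring

/-- The case in which one `y a` equals `c` and the other `y i` are units of `R`. -/
theorem Subring.exists_prod_mul_sub_two_mul_add_sq_eq {K ι : Type*} [Field K] [DecidableEq ι]
    (R : Subring K) {c e : K} (hc : c ∈ R) (hc0 : c ≠ 0) (he : e ∈ R) (s : Finset ι) (y : ι → K)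
    {a : ι} (ha : a ∈ s) (hya : y a = c) (hy : ∀ i ∈ s, y i ∈ R)
    (hy' : ∀ i ∈ s, i ≠ a → (y i)⁻¹ ∈ R) :
    ∃ w ∈ R, ∏ i ∈ s, ((y i * (y i - 2 * c) + (2 * c) ^ 2) * e) =
      (∏ i ∈ s, (y i * (y i - 2 * c) * e)) * (1 - (2 * c) ^ 2 * ∑ i ∈ s, 1 / y i ^ 2) +
        c ^ 3 * w := by
  have h2 : (2 : K) ∈ R := ofNat_mem R 2
  have hfac : ∀ i ∈ s.erase a, y i * (y i - 2 * c) * e ∈ R := fun i hi =>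
    mul_mem (mul_mem (hy i (mem_of_mem_erase hi))
      (sub_mem (hy i (mem_of_mem_erase hi)) (mul_mem h2 hc))) he
  obtain ⟨w, hw, h⟩ := R.exists_prod_add_mul_eq (pow_mem hc 2) (s.erase a)
    (fun i => y i * (y i - 2 * c) * e) (fun _ => 2 ^ 2 * e) hfac
    fun _ _ => mul_mem (pow_mem h2 2) he
  have hS : ∑ i ∈ s.erase a, 1 / y i ^ 2 ∈ R := sum_mem fun i hi => by
    rw [one_div, ← inv_pow]
    exact pow_mem (hy' i (mem_of_mem_erase hi) (ne_of_mem_erase hi)) 2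
  have hprod : ∏ i ∈ s.erase a, ((y i * (y i - 2 * c) + (2 * c) ^ 2) * e) =
      ∏ i ∈ s.erase a, (y i * (y i - 2 * c) * e) + c ^ 2 * w := by
    rw [← h]
    exact prod_congr rfl fun i _ => by ring
  refine ⟨c * e * (3 * w - 2 ^ 2 * (∏ i ∈ s.erase a, (y i * (y i - 2 * c) * e)) *
      ∑ i ∈ s.erase a, 1 / y i ^ 2),
    mul_mem (mul_mem hc he) (sub_mem (mul_mem (ofNat_mem R 3) hw)
      (mul_mem (mul_mem (pow_mem h2 2) (prod_mem hfac)) hS)), ?_⟩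
  rw [← mul_prod_erase s _ ha, ← mul_prod_erase s _ ha, ← add_sum_erase s _ ha, hprod, hya]
  field_simp
  ring

theorem stmt2 (p t : ℕ) (hp : p.Prime) (hodd : Odd p) (ht : t = 1 ∨ t = 2)
    (hmod : p % 3 = t) :
    ratCongrPcubed p
      (∑ k ∈ Finset.range ((t * p - 1) / 3 + 1),
        rpoch (1 / 3) k ^ 3 / (k.factorial : ℚ) ^ 3)
      ((rpoch (2 / 3) ((t * p - 1) / 3) ^ 2 / rpoch 1 ((t * p - 1) / 3) ^ 2) *
        (1 + (-1 : ℚ) ^ (t - 1) * ((t : ℚ) * (p : ℚ)) ^ 2 *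
          ∑ i ∈ Finset.Icc 1 ((t * p - 1) / 3), 1 / (3 * (i : ℚ) - 1) ^ 2)) := by
  have : Fact p.Prime := ⟨hp⟩
  have hp0 : 0 < p := hp.pos
  obtain ⟨n, hn⟩ : ∃ n, t * p = 3 * n + 1 := by
    rcases ht with rfl | rfl
    · exact ⟨p / 3, by omega⟩
    · exact ⟨2 * p / 3, by omega⟩
  have hnp : n < p := by rcases ht with rfl | rfl <;> omega
  rw [show (t * p - 1) / 3 = n by omega]
  have hN : (t : ℚ) * p = 3 * n + 1 := by exact_mod_cast hn
  set R := ratIntegralAt p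
  have hpR : (p : ℚ) ∈ R := natCast_mem _ _
  have h3 : (3 : ℚ)⁻¹ ∈ R := by
    exact_mod_cast inv_natCast_mem_ratIntegralAt (p := p) (d := 3) fun h => by
      have := hp.one_lt
      rcases (Nat.dvd_prime Nat.prime_three).1 h with h | h
      · omega
      · rw [h] at hmod; omega
  have hfact : ∀ k ≤ n, (k.factorial : ℚ)⁻¹ ∈ R := fun k hk =>
    inv_natCast_mem_ratIntegralAt fun h => by
      have := (hp.dvd_factorial).1 h
      omega
  have h9 : (1 / 9 : ℚ) ∈ R := by
    convert pow_mem h3 2 using 1; norm_num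
  have hcube : ∃ w ∈ R, ∑ k ∈ range (n + 1), rpoch (1 / 3) k ^ 3 / (k.factorial : ℚ) ^ 3 =
      (-1) ^ n * (∏ j ∈ range n, (((3 * j + 2) * (3 * j + 2 - t * p) + (t * p : ℚ) ^ 2) * (1 / 9))) /
        (n.factorial : ℚ) ^ 2 + p ^ 3 * w := by
    have hterm : ∀ k, ∃ w, k ≤ n → w ∈ R ∧ rpoch (1 / 3) k ^ 3 / (k.factorial : ℚ) ^ 3 =
        (∏ j ∈ range k, ((1 / 3 + (j : ℚ)) ^ 3 + (t * p : ℚ) ^ 3 * (-1 / 27))) /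
          (k.factorial : ℚ) ^ 3 + p ^ 3 * w := by
      intro k
      obtain ⟨w, hw, h⟩ := R.exists_prod_add_mul_eq (pow_mem hpR 3) (range k)
        (fun j => (1 / 3 + (j : ℚ)) ^ 3) (fun _ => (t : ℚ) ^ 3 * -(3⁻¹) ^ 3)
        (fun j _ => pow_mem (add_mem (by simpa using h3) (natCast_mem _ _)) 3)
        fun _ _ => mul_mem (pow_mem (natCast_mem _ _) 3) (neg_mem (pow_mem h3 3))
      refine ⟨-w * ((k.factorial : ℚ)⁻¹) ^ 3, fun hk =>
        ⟨mul_mem (neg_mem hw) (pow_mem (hfact k hk) 3), ?_⟩⟩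
      have hprod : ∏ j ∈ range k, ((1 / 3 + (j : ℚ)) ^ 3 + (t * p : ℚ) ^ 3 * (-1 / 27)) =
          rpoch (1 / 3) k ^ 3 + p ^ 3 * w := by
        rw [rpoch, ← prod_pow, ← h]
        exact prod_congr rfl fun j _ => by ring
      rw [hprod]
      ring
    choose w hw using hterm
    refine ⟨∑ k ∈ range (n + 1), w k,
      sum_mem fun k hk => (hw k (Nat.lt_succ_iff.1 (mem_range.1 hk))).1, ?_⟩
    rw [← sum_prod_cube_sub n (t * p) hN, mul_sum, ← sum_add_distrib]
    exact sum_congr rfl fun k hk => (hw k (Nat.lt_succ_iff.1 (mem_range.1 hk))).2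
  have hsum : ∑ i ∈ Icc 1 n, 1 / (3 * (i : ℚ) - 1) ^ 2 =
      ∑ j ∈ range n, 1 / (3 * (j : ℚ) + 2) ^ 2 := by
    rw [range_eq_Ico, ← Ico_add_one_right_eq_Icc, ← zero_add 1, ← sum_Ico_add' _ 0 n 1]
    exact sum_congr rfl fun j _ => by push_cast; ring
  have hyR : ∀ j : ℕ, (3 * (j : ℚ) + 2) ∈ R := fun j =>
    add_mem (mul_mem (ofNat_mem R 3) (natCast_mem R j)) (ofNat_mem R 2)
  have hyinv : ∀ j : ℕ, ¬ p ∣ 3 * j + 2 → (3 * (j : ℚ) + 2)⁻¹ ∈ R := fun j hj => by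
    exact_mod_cast inv_natCast_mem_ratIntegralAt hj
  have hprod : ∃ w ∈ R,
      ∏ j ∈ range n, (((3 * j + 2) * (3 * j + 2 - t * p) + (t * p : ℚ) ^ 2) * (1 / 9)) =
        (∏ j ∈ range n, ((3 * j + 2) * (3 * j + 2 - t * p : ℚ) * (1 / 9))) *
          (1 + (-1 : ℚ) ^ (t - 1) * ((t : ℚ) * (p : ℚ)) ^ 2 *
            ∑ j ∈ range n, 1 / (3 * (j : ℚ) + 2) ^ 2) + p ^ 3 * w := by
    rcases ht with rfl | rfl
    · obtain ⟨w, hw, h⟩ := R.exists_prod_mul_sub_add_sq_eq hpR h9 (range n)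
        (fun j : ℕ => 3 * (j : ℚ) + 2) (fun j _ => hyR j) (fun j _ => by positivity)
        fun j hj => hyinv j fun hd => by
          have := Nat.le_of_dvd (by omega) hd
          have := mem_range.1 hj
          omega
      exact ⟨w, hw, by simpa using h⟩
    · obtain ⟨w, hw, h⟩ := R.exists_prod_mul_sub_two_mul_add_sq_eq hpR
        (Nat.cast_ne_zero.2 hp0.ne') h9 (range n) (fun j : ℕ => 3 * (j : ℚ) + 2)
        (a := p / 3) (mem_range.2 (by omega))
        (by exact_mod_cast (show 3 * (p / 3) + 2 = p by omega)) (fun j _ => hyR j)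
        fun j hj hja => hyinv j fun hd => by
          obtain ⟨c, hc⟩ := hd
          have := mem_range.1 hj
          have hc2 : c < 2 := by
            by_contra! h2
            have := Nat.mul_le_mul_left p h2
            omega
          interval_cases c <;> omega
      exact ⟨w, hw, by simpa [sub_eq_add_neg] using h⟩
  obtain ⟨w₁, hw₁, h₁⟩ := hcube
  obtain ⟨w₂, hw₂, h₂⟩ := hprod
  refine ratCongrPcubed_of_sub_eq (p := p)
    (w := w₁ + (-1) ^ n * ((n.factorial : ℚ)⁻¹) ^ 2 * w₂)
    (add_mem hw₁ (mul_mem (mul_mem (pow_mem (neg_mem (one_mem R)) n)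
      (pow_mem (hfact n le_rfl) 2)) hw₂)) ?_
  rw [h₁, rpoch_one, rpoch_two_thirds_sq n _ hN, hsum, h₂]
  ring
end

section
/- Let d ≥ 2 and n be positive integers with n ≡ 1 (mod d). Then, as rational functions of q, q^{(n-1)/d} · (q^{d-1};q^d)_{(n-1)/d} / (q^d;q^d)_{(n-1)/d} ≡ (q^2;q^d)_{(n-1)/d} / (q;q^d)_{(n-1)/d} modulo Φ_n(q). -/
open Finset

open Polynomial in
/-- A polynomial over `ℚ` vanishing at a primitive `n`-th root of unity is a multiple of `Φ_n`. -/
theorem cyclotomic_dvd_iff_aeval_eq_zero {n : ℕ} (hn : 0 < n) {ζ : ℂ} (hζ : IsPrimitiveRoot ζ n)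
    (p : ℚ[X]) : cyclotomic n ℚ ∣ p ↔ aeval ζ p = 0 := by
  rw [cyclotomic_eq_minpoly_rat hζ hn, minpoly.dvd_iff]

theorem map_qPoch {K L : Type*} [CommRing K] [CommRing L] (f : K →+* L) (x q : K) (k : ℕ) :
    f (qPoch x q k) = qPoch (f x) (f q) k := by
  simp [qPoch, map_prod]

/-- If `ζ` is a primitive `n`-th root of unity, then `(ζ^a; ζ^d)_k` does not vanish as long as all
exponents lie strictly between `0` and `n`. -/
theorem qPoch_primitiveRoot_ne_zero {K : Type*} [CommRing K] [IsDomain K] {n a d k : ℕ} {ζ : K}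
    (hζ : IsPrimitiveRoot ζ n) (ha : 0 < a) (hk : ∀ i < k, a + d * i < n) :
    qPoch (ζ ^ a) (ζ ^ d) k ≠ 0 := by
  refine Finset.prod_ne_zero_iff.mpr fun i hi => ?_
  rw [← pow_mul, ← pow_add, sub_ne_zero]
  exact (hζ.pow_ne_one_of_pos_of_lt (by omega) (hk i (Finset.mem_range.mp hi))).symm

/-- The reflection identity for `q`-shifted factorials at a root of unity of order dividing
`d * m + 1`. -/
theorem qPoch_reflect_of_pow_eq_one {K : Type*} [CommRing K] {d m : ℕ} (hd : 1 ≤ d) {ζ : K}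
    (hζ : ζ ^ (d * m + 1) = 1) :
    ζ ^ m * qPoch (ζ ^ (d - 1)) (ζ ^ d) m * qPoch ζ (ζ ^ d) m =
      qPoch (ζ ^ 2) (ζ ^ d) m * qPoch (ζ ^ d) (ζ ^ d) m := by
  obtain ⟨e, rfl⟩ := Nat.exists_eq_add_of_le' hd
  unfold qPoch
  rw [← Finset.prod_range_reflect (fun i => 1 - ζ * (ζ ^ (e + 1)) ^ i),
    ← Finset.prod_range_reflect (fun i => 1 - ζ ^ 2 * (ζ ^ (e + 1)) ^ i)]
  nth_rewrite 1 [← Finset.card_range m]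
  rw [← Finset.prod_const, ← Finset.prod_mul_distrib, ← Finset.prod_mul_distrib,
    ← Finset.prod_mul_distrib]
  refine Finset.prod_congr rfl fun i hi => ?_
  obtain ⟨j, rfl⟩ : ∃ j, m = i + j + 1 :=
    ⟨m - 1 - i, by have := Finset.mem_range.mp hi; omega⟩
  rw [show i + j + 1 - 1 - i = j by omega, Nat.add_sub_cancel]
  linear_combination (1 - ζ) * hζ

theorem stmt10 (d n : ℕ) (hd : 2 ≤ d) (hn : 0 < n) (hmod : n % d = 1) :
    ratCongr
      (RatFunc.X ^ ((n - 1) / d) *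
        (qPoch (RatFunc.X ^ (d - 1)) (RatFunc.X ^ d) ((n - 1) / d) /
          qPoch (RatFunc.X ^ d) (RatFunc.X ^ d) ((n - 1) / d)))
      (qPoch (RatFunc.X ^ 2) (RatFunc.X ^ d) ((n - 1) / d) /
        qPoch RatFunc.X (RatFunc.X ^ d) ((n - 1) / d))
      (Polynomial.cyclotomic n ℚ) := by
  obtain ⟨m, rfl⟩ : ∃ m, n = d * m + 1 := ⟨n / d, by rw [← hmod, Nat.div_add_mod]⟩
  rw [Nat.add_sub_cancel, Nat.mul_div_cancel_left m (by omega)]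
  have hζ := Complex.isPrimitiveRoot_exp (d * m + 1) hn.ne'
  set ζ := Complex.exp (2 * Real.pi * Complex.I / ((d * m + 1 : ℕ) : ℂ))
  have hbound : ∀ i < m, d + d * i < d * m + 1 := fun i hi => by
    have := Nat.mul_le_mul_left d (Nat.succ_le_of_lt hi)
    rw [Nat.mul_succ] at this
    omega
  have haeval (x q : Polynomial ℚ) (k : ℕ) : Polynomial.aeval ζ (qPoch x q k) =
      qPoch (Polynomial.aeval ζ x) (Polynomial.aeval ζ q) k :=
    map_qPoch (Polynomial.aeval ζ).toRingHom x q k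
  have halg (x q : Polynomial ℚ) (k : ℕ) :
      algebraMap (Polynomial ℚ) (RatFunc ℚ) (qPoch x q k) = qPoch (algebraMap _ _ x)
        (algebraMap _ _ q) k := map_qPoch _ x q k
  let X : Polynomial ℚ := Polynomial.X
  let B := qPoch (X ^ d) (X ^ d) m
  let D := qPoch X (X ^ d) m
  have hB : Polynomial.aeval ζ B ≠ 0 := by
    simpa [B, X, haeval] using qPoch_primitiveRoot_ne_zero hζ (by omega : 0 < d) hbound
  have hD : Polynomial.aeval ζ D ≠ 0 := by
    simpa [D, X, haeval] using qPoch_primitiveRoot_ne_zero (a := 1) (d := d) (k := m) hζ one_pos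
      fun i hi => (by have := hbound i hi; omega)
  have hB0 : B ≠ 0 := fun h => hB (by rw [h, map_zero])
  have hD0 : D ≠ 0 := fun h => hD (by rw [h, map_zero])
  obtain ⟨r, hr⟩ := (cyclotomic_dvd_iff_aeval_eq_zero hn hζ
    (X ^ m * qPoch (X ^ (d - 1)) (X ^ d) m * D - qPoch (X ^ 2) (X ^ d) m * B)).mpr (by
      simpa [B, D, X, haeval, sub_eq_zero] using
        qPoch_reflect_of_pow_eq_one (by omega : 1 ≤ d) hζ.pow_eq_one)
  refine ⟨r, B * D, mul_ne_zero hB0 hD0, ?_, ?_⟩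
  · refine (((Polynomial.cyclotomic.irreducible_rat hn).coprime_iff_not_dvd).mpr ?_).symm.isRelPrime
    rw [cyclotomic_dvd_iff_aeval_eq_zero hn hζ, map_mul]
    exact mul_ne_zero hB hD
  · have hB' := RatFunc.algebraMap_ne_zero hB0
    have hD' := RatFunc.algebraMap_ne_zero hD0
    rw [← hr]
    simp only [B, D, X, halg, map_sub, map_mul, map_pow, RatFunc.algebraMap_X] at hB' hD' ⊢
    rw [← mul_div_assoc, div_sub_div _ _ hB' hD', mul_comm (qPoch (RatFunc.X ^ d) _ _)
      (qPoch (RatFunc.X ^ 2) _ _)]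
end
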